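/- arXiv:2603.07575 — 2 statements merged into one kernel-verified Lean document; each statement's English description precedes it below -/
import Mathlib

section
/- The Lebesgue measure of K_l equals 1. -/
open MeasureTheory

def Tl (l : ℕ) : Set ℕ :=
  {d | (Even d ∧ d ≤ 2 * l) ∨ (Odd d ∧ 2 * l + 1 ≤ d ∧ d ≤ 4 * l + 1)}

def Kl (l : ℕ) : Set ℝ :=
  {x | ∃ ε : ℕ → ℕ, (∀ i, ε i ∈ Tl l) ∧
    x = ∑' i : ℕ, (ε i : ℝ) / (2 * l + 2) ^ (i + 1)}

open scoped Pointwise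

theorem le_of_mem_Tl {l d : ℕ} (h : d ∈ Tl l) : d ≤ 4 * l + 1 := by
  rcases h with ⟨_, h⟩ | ⟨_, _, h⟩ <;> omega

theorem hasSum_const_digits (l : ℕ) :
    HasSum (fun i : ℕ => (4 * l + 1 : ℝ) / (2 * l + 2) ^ (i + 1)) ((4 * l + 1) / (2 * l + 1)) := by
  have hl : (0 : ℝ) ≤ l := l.cast_nonneg
  have h := (hasSum_geometric_of_lt_one (r := (2 * l + 2 : ℝ)⁻¹) (by positivity)
    (inv_lt_one_of_one_lt₀ (by linarith))).mul_left ((4 * l + 1 : ℝ) / (2 * l + 2))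
  have h0 : ∀ i : ℕ, (4 * l + 1 : ℝ) / (2 * l + 2) ^ (i + 1) =
      (4 * l + 1) / (2 * l + 2) * (2 * l + 2 : ℝ)⁻¹ ^ i := fun i => by
    rw [pow_succ, inv_pow]
    field_simp
  have h1 : (1 - (2 * l + 2 : ℝ)⁻¹) = (2 * l + 1) / (2 * l + 2) := by
    field_simp
    ring
  have h2 : (4 * l + 1 : ℝ) / (2 * l + 2) * (1 - (2 * l + 2 : ℝ)⁻¹)⁻¹ =
      (4 * l + 1) / (2 * l + 1) := by
    rw [h1]
    field_simp
  simpa only [h0, h2] using h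

theorem digit_term_le {l d : ℕ} (h : d ∈ Tl l) (i : ℕ) :
    (d : ℝ) / (2 * l + 2) ^ (i + 1) ≤ (4 * l + 1 : ℝ) / (2 * l + 2) ^ (i + 1) := by
  have : (d : ℝ) ≤ 4 * l + 1 := by exact_mod_cast le_of_mem_Tl h
  gcongr

theorem summable_digits {l : ℕ} {ε : ℕ → ℕ} (h : ∀ i, ε i ∈ Tl l) :
    Summable fun i : ℕ => (ε i : ℝ) / (2 * l + 2) ^ (i + 1) :=
  (hasSum_const_digits l).summable.of_nonneg_of_le (fun i => by positivity)
    fun i => digit_term_le (h i) i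

theorem Kl_nonneg {l : ℕ} {x : ℝ} (h : x ∈ Kl l) : 0 ≤ x := by
  obtain ⟨ε, -, rfl⟩ := h
  exact tsum_nonneg fun i => by positivity

theorem Kl_lt_two {l : ℕ} {x : ℝ} (h : x ∈ Kl l) : x < 2 := by
  obtain ⟨ε, hε, rfl⟩ := h
  have h := hasSum_const_digits l
  refine ((summable_digits hε).tsum_le_tsum (fun i => digit_term_le (hε i) i) h.summable).trans_lt ?_
  rw [h.tsum_eq, div_lt_iff₀ (by positivity)]
  linarith

theorem tsum_digits_succ {l : ℕ} {ε : ℕ → ℕ} (h : ∀ i, ε i ∈ Tl l) :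
    (2 * l + 2 : ℝ) * ∑' i : ℕ, (ε i : ℝ) / (2 * l + 2) ^ (i + 1) =
      ε 0 + ∑' i : ℕ, (ε (i + 1) : ℝ) / (2 * l + 2) ^ (i + 1) := by
  rw [(summable_digits h).tsum_eq_zero_add, mul_add, ← tsum_mul_left]
  congr 1
  · rw [zero_add, pow_one]
    field_simp
  · congr 1
    ext i
    rw [pow_succ _ (i + 1)]
    field_simp

theorem mem_Kl_iff {l : ℕ} {x : ℝ} :
    x ∈ Kl l ↔ ∃ d ∈ Tl l, (2 * l + 2 : ℝ) * x - d ∈ Kl l := by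
  constructor
  · rintro ⟨ε, hε, rfl⟩
    refine ⟨ε 0, hε 0, fun i => ε (i + 1), fun i => hε _, ?_⟩
    rw [tsum_digits_succ hε]
    ring
  · rintro ⟨d, hd, ε, hε, hx⟩
    have hε' : ∀ i, (fun i : ℕ => Nat.casesOn i d ε : ℕ → ℕ) i ∈ Tl l := by
      rintro (_ | i)
      exacts [hd, hε i]
    refine ⟨_, hε', ?_⟩
    have h := tsum_digits_succ hε'
    simp only at h
    rw [← hx] at h
    have hl : (2 * l + 2 : ℝ) ≠ 0 := by positivity
    apply mul_left_cancel₀ hl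
    rw [h]
    change _ = (d : ℝ) + _
    ring

theorem zero_mem_Tl (l : ℕ) : 0 ∈ Tl l := Or.inl ⟨by simp, by simp⟩

theorem zero_mem_Kl (l : ℕ) : (0 : ℝ) ∈ Kl l := ⟨fun _ => 0, fun _ => zero_mem_Tl l, by simp⟩

theorem isCompact_Kl (l : ℕ) : IsCompact (Kl l) := by
  have hfin : (Tl l).Finite := (Set.finite_Iic (4 * l + 1)).subset fun d => le_of_mem_Tl
  have : Finite (Tl l) := hfin
  have hc : Continuous fun ε : ℕ → Tl l => ∑' i : ℕ, ((ε i : ℕ) : ℝ) / (2 * l + 2) ^ (i + 1) := by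
    refine continuous_tsum (fun i => ?_) (hasSum_const_digits l).summable fun i ε => ?_
    · exact (continuous_of_discreteTopology
        (f := fun d : Tl l => ((d : ℕ) : ℝ) / (2 * l + 2) ^ (i + 1))).comp (continuous_apply i)
    · rw [Real.norm_of_nonneg (by positivity)]
      exact digit_term_le (ε i).2 i
  convert isCompact_range hc using 1
  ext x
  constructor
  · rintro ⟨ε, hε, rfl⟩
    exact ⟨fun i => ⟨ε i, hε i⟩, rfl⟩
  · rintro ⟨ε, rfl⟩
    exact ⟨fun i => ε i, fun i => (ε i).2, rfl⟩

theorem exists_digit_of_int (l : ℕ) (n : ℤ) :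
    ∃ d ∈ Tl l, ∃ m : ℤ, n = (2 * l + 2) * m + d := by
  have hb : (0 : ℤ) < 2 * l + 2 := by positivity
  obtain ⟨r, hr⟩ := Int.eq_ofNat_of_zero_le (Int.emod_nonneg n hb.ne')
  have hlt := Int.emod_lt_of_pos n hb
  have hn := Int.mul_ediv_add_emod n (2 * l + 2)
  rw [hr] at hlt hn
  rcases Nat.even_or_odd r with he | ho
  · refine ⟨r, Or.inl ⟨he, ?_⟩, _, hn.symm⟩
    obtain ⟨k, rfl⟩ := he
    push_cast at hlt
    omega
  · by_cases h : 2 * l + 1 ≤ r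
    · exact ⟨r, Or.inr ⟨ho, h, by omega⟩, _, hn.symm⟩
    · refine ⟨r + (2 * l + 2), Or.inr ⟨?_, ?_, ?_⟩, n / (2 * l + 2) - 1, ?_⟩
      · obtain ⟨k, rfl⟩ := ho
        exact ⟨k + l + 1, by ring⟩
      · omega
      · obtain ⟨k, rfl⟩ := ho
        omega
      · push_cast
        linarith

theorem digit_ne_add_base {l d d' : ℕ} (hd : d ∈ Tl l) (hd' : d' ∈ Tl l) :
    d ≠ d' + (2 * l + 2) := by
  intro h
  rcases hd with ⟨⟨k, rfl⟩, hk⟩ | ⟨⟨k, rfl⟩, hk, hk'⟩ <;>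
  rcases hd' with ⟨⟨j, rfl⟩, hj⟩ | ⟨⟨j, rfl⟩, hj, hj'⟩ <;> omega

theorem exists_int_sub_mem_Kl (l : ℕ) (k : ℕ) (m : ℤ) :
    ∃ n : ℤ, (m : ℝ) / (2 * l + 2) ^ k - n ∈ Kl l := by
  induction k with
  | zero => exact ⟨m, by simpa using zero_mem_Kl l⟩
  | succ k ih =>
    obtain ⟨n, hn⟩ := ih
    obtain ⟨d, hd, j, rfl⟩ := exists_digit_of_int l n
    refine ⟨j, mem_Kl_iff.2 ⟨d, hd, ?_⟩⟩
    convert hn using 1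
    push_cast
    rw [pow_succ]
    field_simp
    ring

theorem exists_int_add_mem_Kl (l : ℕ) (x : ℝ) : ∃ n : ℤ, (n : ℝ) + x ∈ Kl l := by
  have hcl : IsClosed (Kl l + Set.range ((↑) : ℤ → ℝ)) :=
    Int.isClosedEmbedding_coe_real.isClosed_range.add_left_of_isCompact (isCompact_Kl l)
  have hx : x ∈ closure (Kl l + Set.range ((↑) : ℤ → ℝ)) := by
    refine Metric.mem_closure_iff.2 fun δ hδ => ?_
    have hl : (0 : ℝ) ≤ l := l.cast_nonneg
    obtain ⟨k, hk⟩ := exists_pow_lt_of_lt_one hδ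
      (inv_lt_one_of_one_lt₀ (by linarith : (1 : ℝ) < 2 * l + 2))
    have hb : (0 : ℝ) < (2 * l + 2) ^ k := by positivity
    obtain ⟨n, hn⟩ := exists_int_sub_mem_Kl l k ⌊x * (2 * l + 2) ^ k⌋
    refine ⟨_, Set.add_mem_add hn ⟨n, rfl⟩, ?_⟩
    rw [sub_add_cancel]
    refine lt_of_le_of_lt ?_ hk
    have h1 := Int.floor_le (x * (2 * l + 2 : ℝ) ^ k)
    have h2 := Int.lt_floor_add_one (x * (2 * l + 2 : ℝ) ^ k)
    rw [Real.dist_eq, inv_pow, abs_le]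
    constructor
    · have : (⌊x * (2 * l + 2 : ℝ) ^ k⌋ : ℝ) / (2 * l + 2) ^ k ≤ x := (div_le_iff₀ hb).2 h1
      have := inv_pos.2 hb
      linarith
    · rw [sub_le_iff_le_add, inv_eq_one_div, ← add_div, le_div_iff₀ hb]
      linarith
  rw [hcl.closure_eq] at hx
  obtain ⟨y, hy, _, ⟨n, rfl⟩, rfl⟩ := hx
  exact ⟨-n, by simpa using hy⟩

theorem volume_preimage_mul_sub (b c : ℝ) (hb : 0 < b) (E : Set ℝ) :
    volume {x : ℝ | b * x - c ∈ E} = ENNReal.ofReal b⁻¹ * volume E := by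
  have h := Real.volume_preimage_mul_left hb.ne' ((· + -c) ⁻¹' E)
  rw [measure_preimage_add_right, abs_of_pos (inv_pos.2 hb)] at h
  rw [← h]
  simp [Set.preimage, sub_eq_add_neg]

theorem overlap_subset (l : ℕ) :
    Kl l ∩ {x | x - 1 ∈ Kl l} ⊆ ⋃ j ∈ Finset.Icc (2 * l + 1) (4 * l + 1),
      {x : ℝ | (2 * l + 2 : ℝ) * x - (j : ℕ) ∈ Kl l ∩ {x | x - 1 ∈ Kl l}} := by
  rintro x ⟨hx, hx'⟩
  obtain ⟨d, hd, hy⟩ := mem_Kl_iff.1 hx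
  obtain ⟨d', hd', hy'⟩ := mem_Kl_iff.1 hx'
  have a1 := Kl_nonneg hy
  have a2 := Kl_lt_two hy
  have a3 := Kl_nonneg hy'
  have a4 := Kl_lt_two hy'
  have b1 : (d : ℤ) < d' + (2 * l + 2) + 2 := by
    have : (d : ℝ) < d' + (2 * l + 2) + 2 := by linarith
    exact_mod_cast this
  have b2 : (d' + (2 * l + 2) : ℤ) < d + 2 := by
    have : (d' + (2 * l + 2) : ℝ) < d + 2 := by linarith
    exact_mod_cast this
  have b3 : d ≠ d' + (2 * l + 2) := digit_ne_add_base hd hd'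
  have b4 : d = d' + (2 * l + 1) ∨ d = d' + (2 * l + 3) := by omega
  have b5 := le_of_mem_Tl hd
  simp only [Set.mem_iUnion, Finset.mem_Icc]
  rcases b4 with rfl | rfl
  · refine ⟨_, ⟨by omega, b5⟩, hy, ?_⟩
    rw [Set.mem_ofPred_eq]
    convert hy' using 1
    push_cast
    ring
  · refine ⟨d' + (2 * l + 2), ⟨by omega, by omega⟩, ?_, ?_⟩
    · convert hy' using 1
      push_cast
      ring
    · rw [Set.mem_ofPred_eq]
      convert hy using 1
      push_cast
      ring

theorem volume_overlap (l : ℕ) : volume (Kl l ∩ {x | x - 1 ∈ Kl l}) = 0 := by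
  have hb : (0 : ℝ) < 2 * l + 2 := by positivity
  have hle := (measure_mono (μ := volume) (overlap_subset l)).trans
    (measure_biUnion_finset_le _ _)
  simp only [volume_preimage_mul_sub _ _ hb, Finset.sum_const, Nat.card_Icc, nsmul_eq_mul] at hle
  have hfin : volume (Kl l ∩ {x | x - 1 ∈ Kl l}) ≠ ⊤ :=
    ((measure_mono Set.inter_subset_left).trans_lt (isCompact_Kl l).measure_lt_top).ne
  generalize volume (Kl l ∩ {x | x - 1 ∈ Kl l}) = v at hle hfin
  lift v to NNReal using hfin
  have hcard : 4 * l + 1 + 1 - (2 * l + 1) = 2 * l + 1 := by omega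
  have hv := ENNReal.toReal_mono (by finiteness) hle
  simp only [ENNReal.toReal_mul, ENNReal.toReal_natCast, ENNReal.coe_toReal, hcard,
    ENNReal.toReal_ofReal (inv_pos.2 hb).le] at hv
  push_cast at hv
  have h2 : (2 * l + 2 : ℝ) * v ≤ (2 * l + 1) * v := by
    calc (2 * l + 2 : ℝ) * v ≤ (2 * l + 2) * ((2 * l + 1) * ((2 * l + 2 : ℝ)⁻¹ * v)) := by gcongr
      _ = _ := by field_simp
  have h3 : (v : ℝ) = 0 := le_antisymm (by linarith) v.2
  exact_mod_cast h3

theorem isAddFundamentalDomain_Kl (l : ℕ) :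
    IsAddFundamentalDomain (AddSubgroup.zmultiples (1 : ℝ)) (Kl l) volume := by
  refine IsAddFundamentalDomain.mk'' (isCompact_Kl l).measurableSet.nullMeasurableSet
    (Filter.Eventually.of_forall fun x => ?_) ?_
    fun g => (measurePreserving_vadd g volume).quasiMeasurePreserving
  · obtain ⟨n, hn⟩ := exists_int_add_mem_Kl l x
    exact ⟨⟨n, n, by simp⟩, hn⟩
  · rintro ⟨_, n, rfl⟩ hg
    have hn : n ≠ 0 := by
      rintro rfl
      exact hg (by ext; simp)
    rw [AEDisjoint]
    have key : ∀ x, x ∈ ((⟨n • (1 : ℝ), n, rfl⟩ : AddSubgroup.zmultiples (1 : ℝ)) +ᵥ Kl l) ∩ Kl l →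
        x - n ∈ Kl l ∧ x ∈ Kl l := by
      rintro _ ⟨⟨y, hy, rfl⟩, hx⟩
      refine ⟨?_, hx⟩
      simpa [AddSubgroup.vadd_def] using hy
    have hsub : ((⟨n • (1 : ℝ), n, rfl⟩ : AddSubgroup.zmultiples (1 : ℝ)) +ᵥ Kl l) ∩ Kl l ⊆
        (Kl l ∩ {x | x - 1 ∈ Kl l}) ∪ (· + 1) ⁻¹' (Kl l ∩ {x | x - 1 ∈ Kl l}) := by
      intro x hx
      obtain ⟨h1, h2⟩ := key x hx
      have a1 := Kl_nonneg h1
      have a2 := Kl_lt_two h1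
      have a3 := Kl_nonneg h2
      have a4 := Kl_lt_two h2
      have b1 : n < 2 := by
        have : (n : ℝ) < 2 := by linarith
        exact_mod_cast this
      have b2 : -2 < n := by
        have : (-2 : ℝ) < n := by linarith
        exact_mod_cast this
      obtain rfl | rfl : n = 1 ∨ n = -1 := by omega
      · exact Or.inl ⟨h2, by simpa using h1⟩
      · exact Or.inr ⟨by simpa using h1, by simpa using h2⟩
    refine measure_mono_null hsub (measure_union_null (volume_overlap l) ?_)
    rw [measure_preimage_add_right, volume_overlap]

theorem stmt12 (l : ℕ) (hl : 1 ≤ l) : volume (Kl l) = 1 := by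
  rw [(isAddFundamentalDomain_Kl l).measure_eq (isAddFundamentalDomain_Ioc one_pos 0)]
  simp
end

section
/- The boundary of the Guthrie–Nymann set K_1 = { ∑_{n=1}^∞ ε_n/4^n : (ε_n) ∈ {0,2,3,5}^ℕ } has Hausdorff dimension log 3 / log 4. -/
open MeasureTheory

def GN : Set ℝ :=
  {x | ∃ ε : ℕ → ℕ, (∀ n, ε n ∈ ({0, 2, 3, 5} : Set ℕ)) ∧
    x = ∑' n : ℕ, (ε n : ℝ) / 4 ^ (n + 1)}

open Filter Topology Set
open scoped NNReal ENNReal Pointwise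

/-- The real number with base-`b` digits `ε 0, ε 1, …` after the point. -/
noncomputable def digitSum (b : ℝ) (ε : ℕ → ℕ) : ℝ := ∑' n : ℕ, (ε n : ℝ) / b ^ (n + 1)

/-- The set of all numbers having a base-`b` expansion with digits in `D`. -/
def digitSet (b : ℝ) (D : Set ℕ) : Set ℝ := {x | ∃ ε : ℕ → ℕ, (∀ n, ε n ∈ D) ∧ x = digitSum b ε}

section Expansions

variable {b : ℝ} {D : Set ℕ} {M : ℕ}

theorem eq_digitSum_of_recurrence (hb : 1 < b) {ε : ℕ → ℕ} {a : ℕ → ℝ} {B : ℝ}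
    (hB : ∀ n, |a n| ≤ B) (ha : ∀ n, a (n + 1) = b * a n - ε n) : a 0 = digitSum b ε := by
  have hb0 : 0 < b := by linarith
  have partial_sum : ∀ n, ∑ i ∈ Finset.range n, (ε i : ℝ) / b ^ (i + 1) = a 0 - a n / b ^ n := by
    intro n
    induction n with
    | zero => simp
    | succ n ih =>
      rw [Finset.sum_range_succ, ih, ha]
      field_simp
      ring
  have remainder : Tendsto (fun n => a n / b ^ n) atTop (𝓝 0) := by
    have geom : Tendsto (fun n => B * b⁻¹ ^ n) atTop (𝓝 0) := by
      simpa using (tendsto_pow_atTop_nhds_zero_of_lt_one (by positivity)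
        (inv_lt_one_of_one_lt₀ hb)).const_mul B
    refine squeeze_zero_norm (fun n => ?_) geom
    rw [Real.norm_eq_abs, abs_div, abs_of_pos (pow_pos hb0 n), inv_pow, ← div_eq_mul_inv]
    gcongr
    exact hB n
  have hs : HasSum (fun n => (ε n : ℝ) / b ^ (n + 1)) (a 0) := by
    rw [hasSum_iff_tendsto_nat_of_nonneg (fun i => by positivity)]
    simp_rw [partial_sum]
    simpa using remainder.const_sub (a 0)
  exact hs.tsum_eq.symm

/-- Coinduction principle for membership in `digitSet`. -/
theorem subset_digitSet (hb : 1 < b) {A : Set ℝ} {B : ℝ} (hB : ∀ x ∈ A, |x| ≤ B)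
    (hA : ∀ x ∈ A, ∃ d ∈ D, b * x - (d : ℕ) ∈ A) : A ⊆ digitSet b D := by
  choose! f hfD hfA using hA
  intro x hx
  let a : ℕ → ℝ := fun n => (fun y => b * y - f y)^[n] x
  have hsucc : ∀ n, a (n + 1) = b * a n - f (a n) := fun n => Function.iterate_succ_apply' _ _ _
  have ha : ∀ n, a n ∈ A := by
    intro n
    induction n with
    | zero => exact hx
    | succ n ih => rw [hsucc]; exact hfA _ ih
  exact ⟨fun n => f (a n), fun n => hfD _ (ha n),
    eq_digitSum_of_recurrence hb (fun n => hB _ (ha n)) hsucc⟩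

theorem summable_digits_s18 (hb : 1 < b) {ε : ℕ → ℕ} (hε : ∀ n, ε n ≤ M) :
    Summable fun n => (ε n : ℝ) / b ^ (n + 1) := by
  have hb0 : 0 < b := by linarith
  have hg : Summable fun n : ℕ => (M / b : ℝ) * b⁻¹ ^ n :=
    (summable_geometric_of_lt_one (by positivity) (inv_lt_one_of_one_lt₀ hb)).mul_left _
  refine Summable.of_nonneg_of_le (fun n => by positivity) (fun n => ?_) hg
  calc (ε n : ℝ) / b ^ (n + 1) ≤ M / b ^ (n + 1) := by
        gcongr
        exact_mod_cast hε n
    _ = M / b * b⁻¹ ^ n := by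
        rw [pow_succ', inv_pow, ← div_eq_mul_inv, div_div]

theorem digitSum_nonneg (hb : 1 < b) (ε : ℕ → ℕ) : 0 ≤ digitSum b ε :=
  tsum_nonneg fun n => by
    have : 0 < b := by linarith
    positivity

theorem mul_digitSum (hb : 1 < b) {ε : ℕ → ℕ} (hε : ∀ n, ε n ≤ M) :
    b * digitSum b ε = ε 0 + digitSum b fun n => ε (n + 1) := by
  have hb0 : 0 < b := by linarith
  rw [digitSum, (summable_digits_s18 hb hε).tsum_eq_zero_add, digitSum, mul_add, ← tsum_mul_left]
  congr 1
  · rw [zero_add, pow_one, mul_div_cancel₀ _ hb0.ne']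
  · congr 1
    ext n
    field_simp
    ring

theorem digitSum_le (hb : 1 < b) {ε : ℕ → ℕ} (hε : ∀ n, ε n ≤ M) :
    digitSum b ε ≤ M / (b - 1) := by
  have hb0 : 0 < b := by linarith
  have hb1 : 0 < b - 1 := by linarith
  have hconst : digitSum b (fun _ => M) = M / (b - 1) := by
    have h := mul_digitSum (M := M) hb (ε := fun _ => M) fun _ => le_rfl
    rw [eq_div_iff hb1.ne']
    linarith
  rw [← hconst]
  refine (summable_digits_s18 hb hε).tsum_le_tsum (fun n => ?_)
    (summable_digits_s18 (M := M) hb fun _ => le_rfl)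
  gcongr
  exact_mod_cast hε n

theorem nonneg_of_mem_digitSet (hb : 1 < b) {x : ℝ} (hx : x ∈ digitSet b D) : 0 ≤ x := by
  obtain ⟨ε, -, rfl⟩ := hx
  exact digitSum_nonneg hb ε

theorem le_of_mem_digitSet (hb : 1 < b) (hD : ∀ d ∈ D, d ≤ M) {x : ℝ} (hx : x ∈ digitSet b D) :
    x ≤ M / (b - 1) := by
  obtain ⟨ε, hε, rfl⟩ := hx
  exact digitSum_le hb fun n => hD _ (hε n)

theorem abs_le_of_mem_digitSet (hb : 1 < b) (hD : ∀ d ∈ D, d ≤ M) {x : ℝ}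
    (hx : x ∈ digitSet b D) : |x| ≤ M / (b - 1) := by
  rw [abs_of_nonneg (nonneg_of_mem_digitSet hb hx)]
  exact le_of_mem_digitSet hb hD hx

theorem exists_digit_of_mem_digitSet (hb : 1 < b) (hD : ∀ d ∈ D, d ≤ M) {x : ℝ}
    (hx : x ∈ digitSet b D) : ∃ d ∈ D, b * x - (d : ℕ) ∈ digitSet b D := by
  obtain ⟨ε, hε, rfl⟩ := hx
  refine ⟨ε 0, hε 0, fun n => ε (n + 1), fun n => hε _, ?_⟩
  rw [mul_digitSum hb fun n => hD _ (hε n)]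
  ring

theorem add_div_mem_digitSet (hb : 1 < b) (hD : ∀ d ∈ D, d ≤ M) {x : ℝ} {d : ℕ} (hd : d ∈ D)
    (hx : x ∈ digitSet b D) : (d + x) / b ∈ digitSet b D := by
  obtain ⟨ε, hε, rfl⟩ := hx
  let η : ℕ → ℕ := fun n => Nat.casesOn n d ε
  have hη : ∀ n, η n ∈ D := by
    rintro (_ | n)
    exacts [hd, hε n]
  refine ⟨η, hη, ?_⟩
  rw [div_eq_iff (by linarith), mul_comm, mul_digitSum hb fun n => hD _ (hη n)]
  rfl

theorem isClosed_digitSet (hb : 1 < b) (hD : ∀ d ∈ D, d ≤ M) : IsClosed (digitSet b D) := by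
  have hfin : D.Finite := (finite_Iic M).subset hD
  have hbdd : digitSet b D ⊆ {x | |x| ≤ M / (b - 1)} := fun x hx => abs_le_of_mem_digitSet hb hD hx
  have hcover : digitSet b D ⊆
      ⋃ d ∈ D, (fun x : ℝ => b * x - (d : ℕ)) ⁻¹' closure (digitSet b D) := by
    intro x hx
    obtain ⟨d, hd, h⟩ := exists_digit_of_mem_digitSet hb hD hx
    exact mem_biUnion hd (subset_closure h)
  refine isClosed_of_closure_subset (subset_digitSet hb (B := M / (b - 1)) ?_ ?_)
  · exact closure_minimal hbdd (isClosed_le continuous_abs continuous_const)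
  · intro x hx
    have := closure_minimal hcover
      (hfin.isClosed_biUnion fun d _ => isClosed_closure.preimage (by fun_prop)) hx
    simpa using this

theorem isCompact_digitSet (hb : 1 < b) (hD : ∀ d ∈ D, d ≤ M) : IsCompact (digitSet b D) :=
  isCompact_Icc.of_isClosed_subset (isClosed_digitSet hb hD) fun _ hx =>
    ⟨nonneg_of_mem_digitSet hb hx, le_of_mem_digitSet hb hD hx⟩

/-- Digit sets contain arbitrarily small affine copies of themselves around each of their points. -/
theorem exists_small_copy (hb : 1 < b) (hD : ∀ d ∈ D, d ≤ M) (n : ℕ) {x : ℝ}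
    (hx : x ∈ digitSet b D) : ∃ t : ℝ, b ^ n * x - t ∈ digitSet b D ∧
      ∀ y ∈ digitSet b D, (t + y) / b ^ n ∈ digitSet b D := by
  have hb0 : b ≠ 0 := by linarith
  induction n generalizing x with
  | zero => exact ⟨0, by simpa using hx, fun y hy => by simpa using hy⟩
  | succ n ih =>
    obtain ⟨d, hd, h⟩ := exists_digit_of_mem_digitSet hb hD hx
    obtain ⟨t, ht, hcopy⟩ := ih h
    refine ⟨b ^ n * d + t, ?_, fun y hy => ?_⟩
    · convert ht using 1
      ring
    · convert add_div_mem_digitSet hb hD hd (hcopy y hy) using 1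
      field_simp
      ring

end Expansions

section CantorSet

/-- The Cantor set of numbers with base-four digits `0`, `1` and `2`. -/
def cantorFour : Set ℝ := digitSet 4 (Iic 2)

theorem nonneg_of_mem_cantorFour {x : ℝ} (hx : x ∈ cantorFour) : 0 ≤ x :=
  nonneg_of_mem_digitSet (by norm_num) hx

theorem le_of_mem_cantorFour {x : ℝ} (hx : x ∈ cantorFour) : x ≤ 2 / 3 := by
  have := le_of_mem_digitSet (M := 2) (by norm_num) (fun _ h => h) hx
  norm_num at this
  exact this

theorem exists_digit_of_mem_cantorFour {x : ℝ} (hx : x ∈ cantorFour) :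
    ∃ d : ℕ, d < 3 ∧ 4 * x - d ∈ cantorFour := by
  obtain ⟨d, hd, h⟩ := exists_digit_of_mem_digitSet (M := 2) (by norm_num) (fun _ => mem_Iic.1) hx
  exact ⟨d, Nat.lt_succ_of_le hd, h⟩

/-- The left endpoints of the level-`n` intervals of `cantorFour`. -/
noncomputable def cantorFourPoints : ℕ → Finset ℝ
  | 0 => {0}
  | n + 1 => (Finset.range 3 ×ˢ cantorFourPoints n).image fun p => ((p.1 : ℝ) + p.2) / 4

theorem card_cantorFourPoints_le (n : ℕ) : (cantorFourPoints n).card ≤ 3 ^ n := by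
  induction n with
  | zero => simp [cantorFourPoints]
  | succ n ih =>
    refine Finset.card_image_le.trans ?_
    rw [Finset.card_product, Finset.card_range, pow_succ']
    gcongr

theorem exists_cantorFourPoints_near (n : ℕ) {x : ℝ} (hx : x ∈ cantorFour) :
    ∃ p ∈ cantorFourPoints n, x ∈ Icc p (p + (1 / 4) ^ n) := by
  induction n generalizing x with
  | zero =>
    have := nonneg_of_mem_cantorFour hx
    have := le_of_mem_cantorFour hx
    refine ⟨0, by simp [cantorFourPoints], ?_, ?_⟩ <;> norm_num <;> linarith
  | succ n ih =>
    obtain ⟨d, hd, h⟩ := exists_digit_of_mem_cantorFour hx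
    obtain ⟨p, hp, h1, h2⟩ := ih h
    refine ⟨(d + p) / 4, ?_, ?_, ?_⟩
    · exact Finset.mem_image.2 ⟨(d, p), Finset.mem_product.2 ⟨Finset.mem_range.2 hd, hp⟩, rfl⟩
    · linarith
    · rw [pow_succ]
      linarith

/-- The exponent `log 3 / log 4`. -/
noncomputable def cantorFourExp : ℝ≥0 := Real.toNNReal (Real.log 3 / Real.log 4)

theorem coe_cantorFourExp : (cantorFourExp : ℝ) = Real.log 3 / Real.log 4 :=
  Real.coe_toNNReal _ (div_nonneg (Real.log_nonneg (by norm_num)) (Real.log_nonneg (by norm_num)))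

theorem four_rpow_cantorFourExp : (4 : ℝ) ^ (cantorFourExp : ℝ) = 3 := by
  rw [coe_cantorFourExp]
  exact Real.rpow_logb (by norm_num) (by norm_num) (by norm_num)

theorem cantorFourExp_pos : 0 < cantorFourExp :=
  Real.toNNReal_pos.2 (div_pos (Real.log_pos (by norm_num)) (Real.log_pos (by norm_num)))

theorem cantorFourExp_lt_one : cantorFourExp < 1 := by
  rw [← NNReal.coe_lt_coe, coe_cantorFourExp, NNReal.coe_one,
    div_lt_one (Real.log_pos (by norm_num))]
  exact Real.log_lt_log (by norm_num) (by norm_num)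

theorem quarter_pow_rpow_cantorFourExp (n : ℕ) :
    ((1 / 4 : ℝ) ^ n) ^ (cantorFourExp : ℝ) = (1 / 3) ^ n := by
  rw [← Real.rpow_natCast, ← Real.rpow_mul (by norm_num), mul_comm, Real.rpow_mul (by norm_num),
    Real.rpow_natCast, Real.div_rpow (by norm_num) (by norm_num), four_rpow_cantorFourExp,
    Real.one_rpow]

theorem dimH_cantorFour_le : dimH cantorFour ≤ cantorFourExp := by
  refine dimH_le_of_hausdorffMeasure_ne_top (ne_top_of_le_ne_top ENNReal.one_ne_top ?_)
  have hdiam : ∀ (n : ℕ) (p : cantorFourPoints n),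
      Metric.ediam (Icc (p : ℝ) (p + (1 / 4) ^ n)) = ENNReal.ofReal ((1 / 4) ^ n) := by
    intro n p
    rw [Real.ediam_Icc, add_sub_cancel_left]
  have hr : Tendsto (fun n : ℕ => ENNReal.ofReal ((1 / 4 : ℝ) ^ n)) atTop (𝓝 0) := by
    rw [← ENNReal.ofReal_zero]
    exact ENNReal.tendsto_ofReal
      (tendsto_pow_atTop_nhds_zero_of_lt_one (by norm_num) (by norm_num))
  refine (Measure.hausdorffMeasure_le_liminf_sum (cantorFourExp : ℝ) cantorFour
    (fun n : ℕ => ENNReal.ofReal ((1 / 4 : ℝ) ^ n)) hr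
    (fun n (p : cantorFourPoints n) => Icc (p : ℝ) (p + (1 / 4) ^ n))
    (Eventually.of_forall fun n p => (hdiam n p).le)
    (Eventually.of_forall fun n x hx => ?_)).trans ?_
  · obtain ⟨p, hp, h⟩ := exists_cantorFourPoints_near n hx
    exact mem_iUnion.2 ⟨⟨p, hp⟩, h⟩
  · refine liminf_le_of_le (by isBoundedDefault) fun c hc => ?_
    obtain ⟨n, hn⟩ := hc.exists
    refine hn.trans ?_
    simp_rw [hdiam]
    rw [Finset.sum_const, ENNReal.ofReal_rpow_of_nonneg (by positivity) (by positivity),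
      quarter_pow_rpow_cantorFourExp, nsmul_eq_mul, Finset.card_univ, Fintype.card_coe]
    calc ((cantorFourPoints n).card : ℝ≥0∞) * ENNReal.ofReal ((1 / 3) ^ n)
        ≤ ENNReal.ofReal (3 ^ n) * ENNReal.ofReal ((1 / 3) ^ n) := by
          gcongr
          rw [← ENNReal.ofReal_natCast]
          exact ENNReal.ofReal_le_ofReal (by exact_mod_cast card_cantorFourPoints_le n)
      _ = 1 := by
          rw [← ENNReal.ofReal_mul (by positivity), ← mul_pow]
          norm_num

theorem abs_digitSum_three_sub_le {n : ℕ} {δ η : ℕ → ℕ} (hδ : ∀ i, δ i ≤ 2) (hη : ∀ i, η i ≤ 2)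
    (h : |digitSum 4 δ - digitSum 4 η| < 1 / 3 * (1 / 4) ^ n) :
    |digitSum 3 δ - digitSum 3 η| ≤ (1 / 3) ^ n := by
  induction n generalizing δ η with
  | zero =>
    have h1 := digitSum_nonneg (b := 3) (by norm_num) δ
    have h2 := digitSum_nonneg (b := 3) (by norm_num) η
    have h3 := digitSum_le (b := 3) (by norm_num) hδ
    have h4 := digitSum_le (b := 3) (by norm_num) hη
    norm_num at h3 h4
    rw [pow_zero, abs_le]
    constructor <;> linarith
  | succ n ih =>
    have e1 := mul_digitSum (b := 4) (by norm_num) hδ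
    have e2 := mul_digitSum (b := 4) (by norm_num) hη
    have e3 := mul_digitSum (b := 3) (by norm_num) hδ
    have e4 := mul_digitSum (b := 3) (by norm_num) hη
    have h1 := digitSum_nonneg (b := 4) (by norm_num) fun i => δ (i + 1)
    have h2 := digitSum_nonneg (b := 4) (by norm_num) fun i => η (i + 1)
    have h3 := digitSum_le (b := 4) (by norm_num) fun i => hδ (i + 1)
    have h4 := digitSum_le (b := 4) (by norm_num) fun i => hη (i + 1)
    norm_num at h3 h4
    rw [pow_succ, abs_lt] at h
    have hpow : (1 / 4 : ℝ) ^ n ≤ 1 := pow_le_one₀ (by norm_num) (by norm_num)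
    have heq : δ 0 = η 0 := by
      rcases lt_trichotomy (δ 0) (η 0) with hlt | heq | hlt
      · have : (δ 0 : ℝ) + 1 ≤ η 0 := by exact_mod_cast hlt
        linarith
      · exact heq
      · have : (η 0 : ℝ) + 1 ≤ δ 0 := by exact_mod_cast hlt
        linarith
    rw [heq] at e1 e3
    have key := ih (fun i => hδ (i + 1)) (fun i => hη (i + 1))
      (by rw [abs_lt]; constructor <;> linarith)
    rw [pow_succ]
    rw [abs_le] at key ⊢
    constructor <;> linarith

theorem abs_digitSum_three_sub_le_rpow {δ η : ℕ → ℕ} (hδ : ∀ i, δ i ≤ 2) (hη : ∀ i, η i ≤ 2) :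
    |digitSum 3 δ - digitSum 3 η| ≤ 9 * |digitSum 4 δ - digitSum 4 η| ^ (cantorFourExp : ℝ) := by
  set r := |digitSum 4 δ - digitSum 4 η| with hr
  have hr0 : 0 ≤ r := abs_nonneg _
  rcases hr0.eq_or_lt with h0 | hpos
  · have hlim : Tendsto (fun n : ℕ => (1 / 3 : ℝ) ^ n) atTop (𝓝 0) :=
      tendsto_pow_atTop_nhds_zero_of_lt_one (by norm_num) (by norm_num)
    have : |digitSum 3 δ - digitSum 3 η| ≤ 0 := ge_of_tendsto' hlim fun n =>
      abs_digitSum_three_sub_le hδ hη (by rw [← hr, ← h0]; positivity)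
    exact this.trans (by positivity)
  have h3 : (3 * r) ^ (cantorFourExp : ℝ) ≤ 3 * r ^ (cantorFourExp : ℝ) := by
    rw [Real.mul_rpow (by norm_num) hr0]
    gcongr
    calc (3 : ℝ) ^ (cantorFourExp : ℝ) ≤ 3 ^ (1 : ℝ) :=
          Real.rpow_le_rpow_of_exponent_le (by norm_num) (by exact_mod_cast cantorFourExp_lt_one.le)
      _ = 3 := Real.rpow_one 3
  suffices h : |digitSum 3 δ - digitSum 3 η| ≤ 3 * (3 * r) ^ (cantorFourExp : ℝ) by linarith
  have hr1 : 3 * r ≤ 2 := by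
    have h1 := digitSum_nonneg (b := 4) (by norm_num) δ
    have h2 := digitSum_nonneg (b := 4) (by norm_num) η
    have h3 := digitSum_le (b := 4) (by norm_num) hδ
    have h4 := digitSum_le (b := 4) (by norm_num) hη
    norm_num at h3 h4
    have : r ≤ 2 / 3 := by
      rw [hr, abs_le]
      constructor <;> linarith
    linarith
  rcases lt_or_ge (3 * r) 1 with hlt | hge
  · obtain ⟨n, hn, hn'⟩ := exists_nat_pow_near_of_lt_one (y := (1 / 4 : ℝ)) (x := 3 * r)
      (by positivity) hlt.le (by norm_num) (by norm_num)
    rcases hn'.eq_or_lt with heq | hlt'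
    · rcases n with _ | n
      · norm_num at heq
        linarith
      · have hb := abs_digitSum_three_sub_le (n := n) hδ hη (by
          rw [← hr]
          have : (1 / 4 : ℝ) ^ (n + 1) < (1 / 4) ^ n :=
            pow_lt_pow_right_of_lt_one₀ (by norm_num) (by norm_num) n.lt_succ_self
          linarith)
        rw [heq, quarter_pow_rpow_cantorFourExp, pow_succ]
        linarith
    · have hb := abs_digitSum_three_sub_le (n := n) hδ hη (by rw [← hr]; linarith)
      have := Real.rpow_le_rpow (by positivity) hn.le (NNReal.coe_nonneg cantorFourExp)
      rw [quarter_pow_rpow_cantorFourExp, pow_succ] at this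
      linarith
  · have h1 : 1 ≤ (3 * r) ^ (cantorFourExp : ℝ) := Real.one_le_rpow hge (by positivity)
    have h2 := digitSum_nonneg (b := 3) (by norm_num) δ
    have h3 := digitSum_nonneg (b := 3) (by norm_num) η
    have h4 := digitSum_le (b := 3) (by norm_num) hδ
    have h5 := digitSum_le (b := 3) (by norm_num) hη
    norm_num at h4 h5
    have : |digitSum 3 δ - digitSum 3 η| ≤ 1 := by
      rw [abs_le]
      constructor <;> linarith
    linarith

theorem Icc_zero_one_subset_digitSet_three : Icc (0 : ℝ) 1 ⊆ digitSet 3 (Iic 2) := by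
  refine subset_digitSet (by norm_num) (B := 1) (fun x hx => abs_le.2 ⟨by linarith [hx.1], hx.2⟩) ?_
  rintro x ⟨h0, h1⟩
  rcases lt_or_ge x (1 / 3) with h | h
  · exact ⟨0, by simp, by constructor <;> push_cast <;> linarith⟩
  rcases lt_or_ge x (2 / 3) with h' | h'
  · exact ⟨1, by simp, by constructor <;> push_cast <;> linarith⟩
  · exact ⟨2, by simp, by constructor <;> push_cast <;> linarith⟩

theorem le_dimH_cantorFour : (cantorFourExp : ℝ≥0∞) ≤ dimH cantorFour := by
  have hdigits : ∀ x ∈ cantorFour, ∃ ε : ℕ → ℕ, (∀ n, ε n ≤ 2) ∧ x = digitSum 4 ε := fun _ h => h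
  choose! ε hε hsum using hdigits
  let f : ℝ → ℝ := fun x => digitSum 3 (ε x)
  have hholder : HolderOnWith 9 cantorFourExp f cantorFour := by
    intro x hx y hy
    have h := abs_digitSum_three_sub_le_rpow (hε x hx) (hε y hy)
    rw [← hsum x hx, ← hsum y hy] at h
    rw [edist_dist, edist_dist, ENNReal.ofReal_rpow_of_nonneg dist_nonneg (by positivity),
      Real.dist_eq, Real.dist_eq]
    calc ENNReal.ofReal |f x - f y| ≤ ENNReal.ofReal (9 * |x - y| ^ (cantorFourExp : ℝ)) :=
          ENNReal.ofReal_le_ofReal h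
      _ = _ := by
          rw [ENNReal.ofReal_mul (by norm_num)]
          norm_num
  have himage : Icc (0 : ℝ) 1 ⊆ f '' cantorFour := by
    intro u hu
    obtain ⟨δ, hδ, rfl⟩ := Icc_zero_one_subset_digitSet_three hu
    have hmem : digitSum 4 δ ∈ cantorFour := ⟨δ, hδ, rfl⟩
    refine ⟨_, hmem, ?_⟩
    have h := abs_digitSum_three_sub_le_rpow (hε _ hmem) hδ
    rw [← hsum _ hmem, sub_self, abs_zero, Real.zero_rpow (by exact_mod_cast cantorFourExp_pos.ne'),
      mul_zero, abs_nonpos_iff] at h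
    exact sub_eq_zero.1 h
  have hdim : (1 : ℝ≥0∞) ≤ dimH cantorFour / cantorFourExp := by
    calc (1 : ℝ≥0∞) = dimH (Icc (0 : ℝ) 1) := by
          rw [Real.dimH_of_nonempty_interior (by simp)]
          simp
      _ ≤ dimH (f '' cantorFour) := dimH_mono himage
      _ ≤ _ := hholder.dimH_image_le cantorFourExp_pos
  rw [ENNReal.le_div_iff_mul_le (by simp [cantorFourExp_pos.ne']) (by simp), one_mul] at hdim
  exact hdim

theorem dimH_cantorFour : dimH cantorFour = cantorFourExp :=
  le_antisymm dimH_cantorFour_le le_dimH_cantorFour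

end CantorSet

section GuthrieNymann

theorem digit_le_five {d : ℕ} (hd : d ∈ ({0, 2, 3, 5} : Set ℕ)) : d ≤ 5 := by
  simp only [mem_insert_iff, mem_singleton_iff] at hd
  omega

theorem nonneg_of_mem_GN {x : ℝ} (hx : x ∈ GN) : 0 ≤ x :=
  nonneg_of_mem_digitSet (b := 4) (by norm_num) hx

theorem le_of_mem_GN {x : ℝ} (hx : x ∈ GN) : x ≤ 5 / 3 := by
  have := le_of_mem_digitSet (b := 4) (by norm_num) (fun _ => digit_le_five) hx
  norm_num at this
  exact this

theorem isCompact_GN : IsCompact GN :=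
  isCompact_digitSet (by norm_num) fun _ => digit_le_five

theorem mem_GN_of_mem_cantorFour {x : ℝ} (hx : x ∈ cantorFour) : x ∈ GN ∧ x + 1 ∈ GN := by
  suffices h : {x | x ∈ cantorFour ∨ x - 1 ∈ cantorFour} ⊆ GN from
    ⟨h (Or.inl hx), h (Or.inr (by simpa using hx))⟩
  refine subset_digitSet (by norm_num) (B := 2) ?_ ?_
  · rintro y (hy | hy) <;> have h1 := nonneg_of_mem_cantorFour hy <;>
      have h2 := le_of_mem_cantorFour hy <;> rw [abs_le] <;> constructor <;> linarith
  · rintro y (hy | hy) <;>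
      obtain ⟨d, hd, h⟩ := exists_digit_of_mem_cantorFour hy <;> interval_cases d
    · exact ⟨0, by simp, Or.inl h⟩
    · exact ⟨0, by simp, Or.inr (by convert h using 1; push_cast; ring)⟩
    · exact ⟨2, by simp, Or.inl h⟩
    · exact ⟨3, by simp, Or.inr (by convert h using 1; push_cast; ring)⟩
    · exact ⟨5, by simp, Or.inl (by convert h using 1; push_cast; ring)⟩
    · exact ⟨5, by simp, Or.inr (by convert h using 1; push_cast; ring)⟩

theorem mem_cantorFour_of_mem_GN {x : ℝ} (hx : x ∈ GN) (hx' : x + 1 ∈ GN) : x ∈ cantorFour := by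
  suffices h : {x | x ∈ GN ∧ x + 1 ∈ GN} ⊆ cantorFour from h ⟨hx, hx'⟩
  refine subset_digitSet (by norm_num) (B := 2) ?_ ?_
  · rintro y ⟨hy, -⟩
    have h1 := nonneg_of_mem_GN hy
    have h2 := le_of_mem_GN hy
    rw [abs_le]
    constructor <;> linarith
  · rintro y ⟨hy, hy'⟩
    obtain ⟨d, hd, h⟩ := exists_digit_of_mem_digitSet (by norm_num) (fun _ => digit_le_five) hy
    obtain ⟨e, he, h'⟩ := exists_digit_of_mem_digitSet (by norm_num) (fun _ => digit_le_five) hy'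
    have h1 := nonneg_of_mem_GN h
    have h2 := le_of_mem_GN h
    have h3 := nonneg_of_mem_GN h'
    have h4 := le_of_mem_GN h'
    change _ ∈ GN at h h'
    have hlo : d + 2 < e := by
      have : (d : ℝ) + 2 < e := by linarith
      exact_mod_cast this
    simp only [mem_insert_iff, mem_singleton_iff] at hd he
    have hcases : d = 0 ∧ e = 3 ∨ d = 0 ∧ e = 5 ∨ d = 2 ∧ e = 5 := by omega
    rcases hcases with ⟨rfl, rfl⟩ | ⟨rfl, rfl⟩ | ⟨rfl, rfl⟩
    · exact ⟨0, by simp, h, by convert h' using 1; push_cast; ring⟩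
    · exact ⟨1, by simp, by convert h' using 1; push_cast; ring,
        by convert h using 1; push_cast; ring⟩
    · exact ⟨2, by simp, h, by convert h' using 1; push_cast; ring⟩

/-- The integer translates of `GN` cover the line. -/
theorem GN_add_int : GN + range ((↑) : ℤ → ℝ) = univ := by
  set T := GN + range ((↑) : ℤ → ℝ) with hT
  have hclosed : IsClosed T := by
    rw [hT, add_comm]
    exact Int.isClosedEmbedding_coe_real.isClosed_range.add_right_of_isCompact isCompact_GN
  have hzero : (0 : ℝ) ∈ GN := ⟨fun _ => 0, by simp, by simp⟩
  have hdiv : ∀ t ∈ T, t / 4 ∈ T := by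
    rintro _ ⟨x, hx, _, ⟨k, rfl⟩, rfl⟩
    have hres : ∃ d ∈ ({0, 2, 3, 5} : Set ℕ), ∃ m : ℤ, k = 4 * m + d := by
      have h4 : k % 4 = 0 ∨ k % 4 = 1 ∨ k % 4 = 2 ∨ k % 4 = 3 := by omega
      rcases h4 with h | h | h | h
      · exact ⟨0, by simp, k / 4, by omega⟩
      · exact ⟨5, by simp, k / 4 - 1, by omega⟩
      · exact ⟨2, by simp, k / 4, by omega⟩
      · exact ⟨3, by simp, k / 4, by omega⟩
    obtain ⟨d, hd, m, rfl⟩ := hres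
    refine ⟨(d + x) / 4, add_div_mem_digitSet (by norm_num) (fun _ => digit_le_five) hd hx,
      m, ⟨m, rfl⟩, ?_⟩
    push_cast
    ring
  have hgrid : ∀ (n : ℕ) (k : ℤ), (k : ℝ) / 4 ^ n ∈ T := by
    intro n k
    induction n with
    | zero => exact ⟨0, hzero, k, ⟨k, rfl⟩, by simp⟩
    | succ n ih =>
      rw [pow_succ, ← div_div]
      exact hdiv _ ih
  refine eq_univ_of_forall fun x => hclosed.mem_of_tendsto (b := atTop)
    (f := fun n : ℕ => (⌊(4 : ℝ) ^ n * x⌋ : ℝ) / 4 ^ n) ?_ (Eventually.of_forall fun n => hgrid n _)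
  have hlim : Tendsto (fun n : ℕ => x - (1 / 4 : ℝ) ^ n) atTop (𝓝 x) := by
    simpa using (tendsto_pow_atTop_nhds_zero_of_lt_one (r := (1 / 4 : ℝ)) (by norm_num)
      (by norm_num)).const_sub x
  refine tendsto_of_tendsto_of_tendsto_of_le_of_le hlim tendsto_const_nhds (fun n => ?_) fun n => ?_
  · have h4 : (0 : ℝ) < 4 ^ n := by positivity
    change x - (1 / 4 : ℝ) ^ n ≤ _
    rw [le_div_iff₀ h4, sub_mul, ← mul_pow]
    norm_num
    linarith [Int.lt_floor_add_one ((4 : ℝ) ^ n * x)]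
  · change _ ≤ x
    rw [div_le_iff₀ (by positivity), mul_comm]
    exact Int.floor_le _

theorem one_le_dimH_GN : 1 ≤ dimH GN := by
  have hcover : (univ : Set ℝ) ⊆ ⋃ k : ℤ, (fun x => x + (k : ℝ)) '' GN := by
    rw [← GN_add_int]
    rintro _ ⟨x, hx, _, ⟨k, rfl⟩, rfl⟩
    exact mem_iUnion.2 ⟨k, x, hx, rfl⟩
  have h := dimH_mono hcover
  rw [Real.dimH_univ, dimH_iUnion] at h
  refine h.trans (iSup_le fun k => ?_)
  exact ((isometry_add_right (k : ℝ)).dimH_image GN).le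

theorem frontier_GN_subset :
    frontier GN ⊆ cantorFour ∪ (fun x => x + 1) '' cantorFour := by
  intro x hx
  have hxK : x ∈ GN := isCompact_GN.isClosed.frontier_subset hx
  have hcompl : GNᶜ ⊆ ((↑) : ℤ → ℝ) '' {0}ᶜ + GN := by
    intro y hy
    obtain ⟨z, hz, _, ⟨k, rfl⟩, rfl⟩ : y ∈ GN + range ((↑) : ℤ → ℝ) := GN_add_int ▸ mem_univ y
    refine ⟨k, ⟨k, ?_, rfl⟩, z, hz, add_comm _ _⟩
    rintro rfl
    simp [hz] at hy
  have hclosed : IsClosed (((↑) : ℤ → ℝ) '' {0}ᶜ + GN) :=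
    (Int.isClosedEmbedding_coe_real.isClosedMap _ (isClosed_discrete _)).add_right_of_isCompact
      isCompact_GN
  rw [frontier_eq_closure_inter_closure] at hx
  obtain ⟨_, ⟨k, hk, rfl⟩, z, hz, rfl⟩ := closure_minimal hcompl hclosed hx.2
  have h1 := nonneg_of_mem_GN hz
  have h2 := le_of_mem_GN hz
  have h3 := nonneg_of_mem_GN hxK
  have h4 := le_of_mem_GN hxK
  simp only at h3 h4
  have hlo : -2 < k := by
    have : (-2 : ℝ) < k := by linarith
    exact_mod_cast this
  have hhi : k < 2 := by
    have : (k : ℝ) < 2 := by linarith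
    exact_mod_cast this
  have hk0 : k ≠ 0 := hk
  obtain rfl | rfl : k = -1 ∨ k = 1 := by omega
  · exact Or.inl (mem_cantorFour_of_mem_GN hxK (by simpa using hz))
  · refine Or.inr ⟨z, mem_cantorFour_of_mem_GN hz ?_, ?_⟩
    · simpa [add_comm] using hxK
    · simp [add_comm]

theorem cantorFour_subset_frontier_GN : cantorFour ⊆ frontier GN := by
  intro x hx
  obtain ⟨hxK, hxK'⟩ := mem_GN_of_mem_cantorFour hx
  refine ⟨subset_closure hxK, fun hint => ?_⟩
  obtain ⟨r, hr, hball⟩ := Metric.mem_nhds_iff.1 (mem_interior_iff_mem_nhds.1 hint)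
  obtain ⟨n, hn⟩ := exists_pow_lt_of_lt_one (show 0 < r / 2 by positivity)
    (show (1 / 4 : ℝ) < 1 by norm_num)
  obtain ⟨t, ht, hcopy⟩ := exists_small_copy (by norm_num) (fun _ => digit_le_five) n hxK'
  have h4 : (0 : ℝ) < 4 ^ n := by positivity
  have hsub : GN ⊆ (fun y : ℝ => 4 ^ n * (y + 1) - t) '' cantorFour := by
    intro y hy
    refine ⟨(t + y) / 4 ^ n - 1, mem_cantorFour_of_mem_GN (hball ?_) ?_, ?_⟩
    · have h1 := nonneg_of_mem_GN hy
      have h2 := le_of_mem_GN hy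
      have h3 := nonneg_of_mem_GN ht
      have h5 := le_of_mem_GN ht
      have heq : (t + y) / 4 ^ n - 1 - x = (y - (4 ^ n * (x + 1) - t)) * (1 / 4) ^ n := by
        rw [one_div, inv_pow]
        field_simp
        ring
      rw [Metric.mem_ball, Real.dist_eq, heq, abs_mul, abs_of_pos (show (0 : ℝ) < (1 / 4) ^ n by
        positivity)]
      have h6 : |y - (4 ^ n * (x + 1) - t)| ≤ 2 := by
        rw [abs_le]
        constructor <;> linarith
      nlinarith [show (0 : ℝ) < (1 / 4) ^ n by positivity]
    · rw [sub_add_cancel]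
      exact hcopy y hy
    · field_simp
      ring
  have hlip : LipschitzWith (4 ^ n) (fun y : ℝ => 4 ^ n * (y + 1) - t) := by
    refine LipschitzWith.of_dist_le_mul fun y z => ?_
    rw [Real.dist_eq, Real.dist_eq]
    push_cast
    rw [← abs_of_pos h4, ← abs_mul, abs_of_pos h4]
    exact (congrArg abs (by ring)).le
  have hdim : (1 : ℝ≥0∞) ≤ cantorFourExp :=
    calc (1 : ℝ≥0∞) ≤ dimH GN := one_le_dimH_GN
      _ ≤ _ := dimH_mono hsub
      _ ≤ dimH cantorFour := hlip.dimH_image_le _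
      _ = cantorFourExp := dimH_cantorFour
  exact absurd (by exact_mod_cast hdim) cantorFourExp_lt_one.not_ge

end GuthrieNymann

theorem stmt18 : dimH (frontier GN) = ENNReal.ofReal (Real.log 3 / Real.log 4) := by
  change _ = (cantorFourExp : ℝ≥0∞)
  refine le_antisymm ((dimH_mono frontier_GN_subset).trans ?_) ?_
  · rw [dimH_union, (isometry_add_right (1 : ℝ)).dimH_image, max_self, dimH_cantorFour]
  · rw [← dimH_cantorFour]
    exact dimH_mono cantorFour_subset_frontier_GN
end
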